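/- Let φ, φ̃ : M → N be two polyharmonic maps of order k ≥ 3 with local variables u_ℓ, v_ℓ and ũ_ℓ, ṽ_ℓ, and let z = (φ − φ̃, dφ − dφ̃, u₀ − ũ₀, v₀ − ṽ₀, u₁ − ũ₁, v₁ − ṽ₁, ..., v_{k−3} − ṽ_{k−3}, u_{k−2} − ũ_{k−2}). Then on any open set D whose closure is compact and contained in the chart domain, there exists a constant C > 0 such that |Δz| ≤ C( |φ − φ̃| + |dφ − dφ̃| + |∇dφ − ∇dφ̃| + Σ_{ℓ=0}^{k−2} |u_ℓ − ũ_ℓ| + Σ_{ℓ=0}^{k−3} ( |v_ℓ − ṽ_ℓ| + |∇v_ℓ − ∇ṽ_ℓ| ) + |∇u_{k−2} − ∇ũ_{k−2}| ), where Δ acts componentwise (as the Laplace–Beltrami operator on each real-valued component of z). -/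

import Mathlib

noncomputable section

open scoped BigOperators

namespace Polyharm

/-- Partial derivative of a scalar function on `ℝ^d` in the `i`-th coordinate direction. -/
def pd {d : ℕ} (i : Fin d) (f : (Fin d → ℝ) → ℝ) (x : Fin d → ℝ) : ℝ :=
  fderiv ℝ f x (Pi.single i 1)

/-- Euclidean norm of a finite family of real numbers. -/
def vnorm {ι : Type} [Fintype ι] (f : ι → ℝ) : ℝ :=
  Real.sqrt (∑ i, f i ^ 2)

/-- Local-coordinate data for maps between Riemannian manifolds: the inverse metric
`g^{ij}` and the Christoffel symbols `Γ^k_{ij}` of a chart of the domain `(M,g)`, and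
the Christoffel symbols `Γ^α_{βγ}` of a chart of the target `(N,h)`. -/
structure ChartData (m n : ℕ) where
  ginv : (Fin m → ℝ) → Fin m → Fin m → ℝ
  ΓM : (Fin m → ℝ) → Fin m → Fin m → Fin m → ℝ
  ΓN : (Fin n → ℝ) → Fin n → Fin n → Fin n → ℝ

variable {m n : ℕ}

/-- Smoothness of the domain data. -/
def ChartData.SmoothDomain (P : ChartData m n) : Prop :=
  (∀ i j, ContDiff ℝ (⊤ : ℕ∞) fun x => P.ginv x i j) ∧
  (∀ k i j, ContDiff ℝ (⊤ : ℕ∞) fun x => P.ΓM x k i j)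

/-- Smoothness of the target Christoffel symbols. -/
def ChartData.SmoothTarget (P : ChartData m n) : Prop :=
  ∀ α β γ, ContDiff ℝ (⊤ : ℕ∞) fun y => P.ΓN y α β γ

/-- The chart data comes from Riemannian metrics: `g^{ij}` is symmetric and positive
definite, and the Christoffel symbols are symmetric in their lower indices. -/
def ChartData.Riemannian (P : ChartData m n) : Prop :=
  (∀ x i j, P.ginv x i j = P.ginv x j i) ∧
  (∀ x (v : Fin m → ℝ), v ≠ 0 → 0 < ∑ i, ∑ j, P.ginv x i j * v i * v j) ∧
  (∀ x k i j, P.ΓM x k i j = P.ΓM x k j i) ∧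
  (∀ y α β γ, P.ΓN y α β γ = P.ΓN y α γ β)

/-- The Laplace–Beltrami operator on scalar functions:
`-Δ f = g^{ij} ∂²f/∂x^i∂x^j - g^{ij} Γ^k_{ij} ∂f/∂x^k`. -/
def lap (P : ChartData m n) (f : (Fin m → ℝ) → ℝ) (x : Fin m → ℝ) : ℝ :=
  -((∑ i, ∑ j, P.ginv x i j * pd i (fun z => pd j f z) x)
    - ∑ i, ∑ j, ∑ k, P.ginv x i j * P.ΓM x k i j * pd k f x)

/-- `φ_i^β = ∂φ^β/∂x^i`. -/
def dphi (φ : (Fin m → ℝ) → Fin n → ℝ) (x : Fin m → ℝ) (i : Fin m) (β : Fin n) : ℝ :=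
  pd i (fun z => φ z β) x

/-- `⟨dφ^β, dψ^γ⟩ = g^{ij} φ_i^β ψ_j^γ`. -/
def dpair (P : ChartData m n) (φ ψ : (Fin m → ℝ) → Fin n → ℝ) (x : Fin m → ℝ)
    (β γ : Fin n) : ℝ :=
  ∑ i, ∑ j, P.ginv x i j * dphi φ x i β * dphi ψ x j γ

/-- Components `R^α_{δβγ}` of the curvature tensor of the target, with the sign
convention `R(∂/∂y^β, ∂/∂y^γ)∂/∂y^δ = R^α_{δβγ} ∂/∂y^α` of the paper. -/
def Rc (P : ChartData m n) (y : Fin n → ℝ) (α δ β γ : Fin n) : ℝ :=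
  pd β (fun z => P.ΓN z α γ δ) y - pd γ (fun z => P.ΓN z α β δ) y
    + ∑ μ, (P.ΓN y α β μ * P.ΓN y μ γ δ - P.ΓN y α γ μ * P.ΓN y μ β δ)

/-- `2S^α_{βωϑ} = ∂Γ^α_{βϑ}/∂y^ω + Γ^γ_{βϑ}Γ^α_{ωγ} + ∂Γ^α_{ωϑ}/∂y^β + Γ^γ_{ωϑ}Γ^α_{βγ}`. -/
def Scoef (P : ChartData m n) (y : Fin n → ℝ) (α β ω ϑ : Fin n) : ℝ :=
  (pd ω (fun z => P.ΓN z α β ϑ) y + (∑ γ, P.ΓN y γ β ϑ * P.ΓN y α ω γ)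
    + pd β (fun z => P.ΓN z α ω ϑ) y + ∑ γ, P.ΓN y γ ω ϑ * P.ΓN y α β γ) / 2

/-- The operator
`A^α(η,ξ) = ξ_i^ϑ(-2 g^{ij} φ_j^β Γ^α_{βϑ}) + η^ϑ((Δφ^β)Γ^α_{βϑ} - g^{ij} φ_j^β φ_i^ω S^α_{βωϑ})`. -/
def Aop (P : ChartData m n) (φ : (Fin m → ℝ) → Fin n → ℝ) (η : Fin n → ℝ)
    (ξ : Fin m → Fin n → ℝ) (x : Fin m → ℝ) (α : Fin n) : ℝ :=
  (∑ ϑ, ∑ i, ξ i ϑ * (-2 * ∑ j, ∑ β, P.ginv x i j * dphi φ x j β * P.ΓN (φ x) α β ϑ))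
    + ∑ ϑ, η ϑ * ((∑ β, lap P (fun z => φ z β) x * P.ΓN (φ x) α β ϑ)
        - ∑ i, ∑ j, ∑ β, ∑ ω,
            P.ginv x i j * dphi φ x j β * dphi φ x i ω * Scoef P (φ x) α β ω ϑ)

/-- The operator `A` applied to (the components of) a section `σ` of `φ⁻¹TN`:
`A(σ, ∂σ)`. -/
def Asec (P : ChartData m n) (φ σ : (Fin m → ℝ) → Fin n → ℝ) (x : Fin m → ℝ)
    (α : Fin n) : ℝ :=
  Aop P φ (σ x) (fun i ϑ => pd i (fun z => σ z ϑ) x) x α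

/-- Components of the tension field `τ^α(φ) = -Δφ^α + g^{ij} Γ^α_{ϑβ} φ_i^ϑ φ_j^β`. -/
def tension (P : ChartData m n) (φ : (Fin m → ℝ) → Fin n → ℝ) (x : Fin m → ℝ)
    (α : Fin n) : ℝ :=
  -(lap P (fun z => φ z α) x)
    + ∑ i, ∑ j, ∑ ϑ, ∑ β,
        P.ginv x i j * P.ΓN (φ x) α ϑ β * dphi φ x i ϑ * dphi φ x j β

/-- The components `u_j` of `Δ̄^j τ(φ)`: `u_0 = τ(φ)` and
`u_{j+1} = Δ u_j + A(u_j, ∂u_j)` (local expression of the rough Laplacian). -/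
def uvar (P : ChartData m n) (φ : (Fin m → ℝ) → Fin n → ℝ) :
    ℕ → (Fin m → ℝ) → Fin n → ℝ
  | 0 => tension P φ
  | j+1 => fun x α => lap P (fun z => uvar P φ j z α) x + Asec P φ (uvar P φ j) x α

/-- `v_j = du_j`, i.e. `v_{j i}^α = ∂u_j^α/∂x^i`. -/
def vvar (P : ChartData m n) (φ : (Fin m → ℝ) → Fin n → ℝ) (j : ℕ) (x : Fin m → ℝ)
    (i : Fin m) (α : Fin n) : ℝ :=
  pd i (fun z => uvar P φ j z α) x

/-- Components of the pull-back covariant derivative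
`(∇̄_{∂_i} σ)^γ = ∂σ^γ/∂x^i + Γ^γ_{βδ}(φ) φ_i^β σ^δ`. -/
def covD (P : ChartData m n) (φ σ : (Fin m → ℝ) → Fin n → ℝ) (i : Fin m)
    (x : Fin m → ℝ) (γ : Fin n) : ℝ :=
  pd i (fun z => σ z γ) x + ∑ β, ∑ δ, P.ΓN (φ x) γ β δ * dphi φ x i β * σ x δ

/-- `(Tr_g R^N(X, dφ(·))dφ(·))^α`. -/
def trRphi (P : ChartData m n) (φ X : (Fin m → ℝ) → Fin n → ℝ) (x : Fin m → ℝ)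
    (α : Fin n) : ℝ :=
  ∑ i, ∑ j, ∑ β, ∑ γ, ∑ δ,
    P.ginv x i j * Rc P (φ x) α δ β γ * X x β * dphi φ x i γ * dphi φ x j δ

/-- `(Tr_g R^N(dφ(·), X)dφ(·))^α`. -/
def trRphi2 (P : ChartData m n) (φ X : (Fin m → ℝ) → Fin n → ℝ) (x : Fin m → ℝ)
    (α : Fin n) : ℝ :=
  ∑ i, ∑ j, ∑ β, ∑ γ, ∑ δ,
    P.ginv x i j * Rc P (φ x) α δ β γ * dphi φ x i β * X x γ * dphi φ x j δ

/-- `(Tr_g R^N(∇̄_{(·)}W, Z)dφ(·))^α`. -/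
def trRD (P : ChartData m n) (φ W Z : (Fin m → ℝ) → Fin n → ℝ) (x : Fin m → ℝ)
    (α : Fin n) : ℝ :=
  ∑ i, ∑ j, ∑ β, ∑ γ, ∑ δ,
    P.ginv x i j * Rc P (φ x) α δ β γ * covD P φ W i x β * Z x γ * dphi φ x j δ

/-- `(Tr_g R^N(W, ∇̄_{(·)}Z)dφ(·))^α`. -/
def trRD2 (P : ChartData m n) (φ W Z : (Fin m → ℝ) → Fin n → ℝ) (x : Fin m → ℝ)
    (α : Fin n) : ℝ :=
  ∑ i, ∑ j, ∑ β, ∑ γ, ∑ δ,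
    P.ginv x i j * Rc P (φ x) α δ β γ * W x β * covD P φ Z i x γ * dphi φ x j δ

/-- Local components of Maeta's `k`-tension field `τ_k(φ)`, for `k = 2s`:
`τ_{2s}(φ) = Δ̄^{2s-1}τ(φ) - R^N(Δ̄^{2s-2}τ(φ), dφ(e_j))dφ(e_j)
  - Σ_{ℓ=1}^{s-1}( R^N(∇̄_{e_j}Δ̄^{s+ℓ-2}τ(φ), Δ̄^{s-ℓ-1}τ(φ))dφ(e_j)
                 - R^N(Δ̄^{s+ℓ-2}τ(φ), ∇̄_{e_j}Δ̄^{s-ℓ-1}τ(φ))dφ(e_j) )`,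
and for `k = 2s+1`:
`τ_{2s+1}(φ) = Δ̄^{2s}τ(φ) - R^N(Δ̄^{2s-1}τ(φ), dφ(e_j))dφ(e_j)
  - Σ_{ℓ=1}^{s-1}( R^N(∇̄_{e_j}Δ̄^{s+ℓ-1}τ(φ), Δ̄^{s-ℓ-1}τ(φ))dφ(e_j)
                 - R^N(Δ̄^{s+ℓ-1}τ(φ), ∇̄_{e_j}Δ̄^{s-ℓ-1}τ(φ))dφ(e_j) )
  - R^N(∇̄_{e_j}Δ̄^{s-1}τ(φ), Δ̄^{s-1}τ(φ))dφ(e_j)`. -/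
def tauK (P : ChartData m n) (φ : (Fin m → ℝ) → Fin n → ℝ) (k : ℕ) (x : Fin m → ℝ)
    (α : Fin n) : ℝ :=
  if Even k then
    uvar P φ (k-1) x α - trRphi P φ (uvar P φ (k-2)) x α
      - ∑ ℓ ∈ Finset.Icc 1 (k/2 - 1),
          (trRD P φ (uvar P φ (k/2 + ℓ - 2)) (uvar P φ (k/2 - ℓ - 1)) x α
            - trRD2 P φ (uvar P φ (k/2 + ℓ - 2)) (uvar P φ (k/2 - ℓ - 1)) x α)
  else
    uvar P φ (k-1) x α - trRphi P φ (uvar P φ (k-2)) x α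
      - (∑ ℓ ∈ Finset.Icc 1 (k/2 - 1),
          (trRD P φ (uvar P φ (k/2 + ℓ - 1)) (uvar P φ (k/2 - ℓ - 1)) x α
            - trRD2 P φ (uvar P φ (k/2 + ℓ - 1)) (uvar P φ (k/2 - ℓ - 1)) x α))
      - trRD P φ (uvar P φ (k/2 - 1)) (uvar P φ (k/2 - 1)) x α

/-- Components `(∇dφ)(∂_i,∂_j)^α` of the second fundamental form of `φ`. -/
def sff (P : ChartData m n) (φ : (Fin m → ℝ) → Fin n → ℝ) (x : Fin m → ℝ)
    (i j : Fin m) (α : Fin n) : ℝ :=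
  pd i (fun z => dphi φ z j α) x - (∑ k, P.ΓM x k i j * dphi φ x k α)
    + ∑ β, ∑ γ, P.ΓN (φ x) α β γ * dphi φ x i β * dphi φ x j γ


/-! ### Smoothness -/

abbrev Sm {d : ℕ} (F : (Fin d → ℝ) → ℝ) : Prop := ContDiff ℝ (⊤ : ℕ∞) F

theorem Sm.pd {d : ℕ} {F : (Fin d → ℝ) → ℝ} (h : Sm F) (i : Fin d) :
    Sm (fun x => pd i F x) := by
  unfold Polyharm.pd
  have h1 : ContDiff ℝ (⊤ : ℕ∞) (fderiv ℝ F) := h.fderiv_right (by simp)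
  exact h1.clm_apply contDiff_const

theorem Sm.diff {d : ℕ} {F : (Fin d → ℝ) → ℝ} (h : Sm F) : Differentiable ℝ F :=
  h.differentiable (by simp)

theorem pd_add {d : ℕ} {F G : (Fin d → ℝ) → ℝ} (hF : Sm F) (hG : Sm G) (i : Fin d) :
    pd i (fun x => F x + G x) = fun x => pd i F x + pd i G x := by
  funext x
  unfold pd
  rw [fderiv_fun_add (hF.diff x) (hG.diff x)]
  rfl

theorem pd_sub {d : ℕ} {F G : (Fin d → ℝ) → ℝ} (hF : Sm F) (hG : Sm G) (i : Fin d) :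
    pd i (fun x => F x - G x) = fun x => pd i F x - pd i G x := by
  funext x
  unfold pd
  rw [fderiv_fun_sub (hF.diff x) (hG.diff x)]
  rfl

theorem pd_neg {d : ℕ} {F : (Fin d → ℝ) → ℝ} (i : Fin d) :
    pd i (fun x => - F x) = fun x => - pd i F x := by
  funext x
  unfold pd
  rw [fderiv_fun_neg]
  rfl

theorem pd_const {d : ℕ} (c : ℝ) (i : Fin d) :
    pd i (fun _ => c) = fun _ => 0 := by
  funext x
  unfold pd
  simp

theorem pd_mul {d : ℕ} {F G : (Fin d → ℝ) → ℝ} (hF : Sm F) (hG : Sm G) (i : Fin d) :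
    pd i (fun x => F x * G x) = fun x => F x * pd i G x + pd i F x * G x := by
  funext x
  unfold pd
  rw [fderiv_fun_mul (hF.diff x) (hG.diff x)]
  simp
  ring

theorem pd_sum {d : ℕ} {ι : Type} (s : Finset ι) {F : ι → (Fin d → ℝ) → ℝ}
    (hF : ∀ a ∈ s, Sm (F a)) (i : Fin d) :
    pd i (fun x => ∑ a ∈ s, F a x) = fun x => ∑ a ∈ s, pd i (F a) x := by
  funext x
  unfold pd
  rw [fderiv_fun_sum (fun a ha => (hF a ha).diff x)]
  simp

theorem pd_comm {d : ℕ} {F : (Fin d → ℝ) → ℝ} (hF : Sm F) (i j : Fin d) :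
    pd i (fun z => pd j F z) = pd j (fun z => pd i F z) := by
  funext x
  have h1 : ContDiff ℝ (⊤ : ℕ∞) (fderiv ℝ F) := hF.fderiv_right (by simp)
  have h2 : DifferentiableAt ℝ (fderiv ℝ F) x := (h1.differentiable (by simp)) x
  have key : ∀ v w : Fin d → ℝ,
      fderiv ℝ (fun z => fderiv ℝ F z v) x w = fderiv ℝ (fderiv ℝ F) x w v := by
    intro v w
    rw [fderiv_clm_apply h2 (differentiableAt_const v)]
    simp
  have hs : IsSymmSndFDerivAt ℝ F x :=
    (hF.contDiffAt).isSymmSndFDerivAt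
      (by simp only [minSmoothness_of_isRCLikeNormedField]; exact WithTop.coe_le_coe.2 (le_top : (2 : ℕ∞) ≤ ⊤))
  unfold pd
  rw [key, key]
  exact hs _ _

theorem pd_comp {m n : ℕ} {h : (Fin n → ℝ) → ℝ} {φ : (Fin m → ℝ) → Fin n → ℝ}
    (hh : Sm h) (hφ : ContDiff ℝ (⊤ : ℕ∞) φ) (i : Fin m) :
    pd i (fun x => h (φ x)) = fun x => ∑ β, pd β h (φ x) * dphi φ x i β := by
  funext x
  have hd : DifferentiableAt ℝ φ x := (hφ.differentiable (by simp)) x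
  have h1 : fderiv ℝ (fun x => h (φ x)) x = (fderiv ℝ h (φ x)).comp (fderiv ℝ φ x) :=
    fderiv_comp x (hh.diff (φ x)) hd
  have h2 : ∀ β, dphi φ x i β = fderiv ℝ φ x (Pi.single i 1) β := by
    intro β
    unfold dphi pd
    rw [fderiv_apply hd β]
    rfl
  unfold pd
  rw [h1]
  simp only [h2, ContinuousLinearMap.comp_apply]
  set w := fderiv ℝ φ x (Pi.single i 1)
  conv_lhs => rw [← Finset.univ_sum_single w]
  rw [map_sum]
  refine Finset.sum_congr rfl fun β _ => ?_
  have : (Pi.single β (w β) : Fin n → ℝ) = w β • Pi.single β (1:ℝ) := by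
    rw [← Pi.single_smul]; simp
  rw [this, map_smul, smul_eq_mul, mul_comm]

theorem Sm.lap {P : ChartData m n} (hP : P.SmoothDomain) {F : (Fin m → ℝ) → ℝ} (h : Sm F) :
    Sm (fun x => lap P F x) := by
  unfold Polyharm.lap
  refine ContDiff.neg (ContDiff.sub ?_ ?_)
  · exact ContDiff.sum fun i _ => ContDiff.sum fun j _ => (hP.1 i j).mul ((h.pd j).pd i)
  · exact ContDiff.sum fun i _ => ContDiff.sum fun j _ => ContDiff.sum fun k _ =>
      ((hP.1 i j).mul (hP.2 k i j)).mul (h.pd k)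

theorem lap_sub {P : ChartData m n} {F G : (Fin m → ℝ) → ℝ} (hF : Sm F) (hG : Sm G)
    (x : Fin m → ℝ) : lap P (fun z => F z - G z) x = lap P F x - lap P G x := by
  unfold lap
  simp only [pd_sub hF hG]
  simp only [pd_sub (hF.pd _) (hG.pd _), mul_sub, Finset.sum_sub_distrib]
  ring

theorem lap_pd {P : ChartData m n} (hP : P.SmoothDomain) {F : (Fin m → ℝ) → ℝ} (h : Sm F)
    (i : Fin m) :
    (fun x => lap P (fun z => pd i F z) x) = fun x => pd i (fun z => lap P F z) x
      + ((∑ a, ∑ b, pd i (fun z => P.ginv z a b) x * pd a (fun z => pd b F z) x)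
      - ∑ a, ∑ b, ∑ k, pd i (fun z => P.ginv z a b * P.ΓM z k a b) x * pd k F x) := by
  have s1 : ∀ a b, Sm (fun x => P.ginv x a b * pd a (fun z => pd b F z) x) :=
    fun a b => (hP.1 a b).mul ((h.pd b).pd a)
  have s2 : ∀ a b k, Sm (fun x => P.ginv x a b * P.ΓM x k a b * pd k F x) :=
    fun a b k => ((hP.1 a b).mul (hP.2 k a b)).mul (h.pd k)
  have e1 : pd i (fun x => lap P F x) = fun x =>
      -((∑ a, ∑ b, (P.ginv x a b * pd a (fun z => pd b (fun y => pd i F y) z) x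
          + pd i (fun z => P.ginv z a b) x * pd a (fun z => pd b F z) x))
        - ∑ a, ∑ b, ∑ k, (P.ginv x a b * P.ΓM x k a b * pd k (fun y => pd i F y) x
          + pd i (fun z => P.ginv z a b * P.ΓM z k a b) x * pd k F x)) := by
    unfold lap
    rw [pd_neg, pd_sub (ContDiff.sum fun a _ => ContDiff.sum fun b _ => s1 a b)
      (ContDiff.sum fun a _ => ContDiff.sum fun b _ => ContDiff.sum fun k _ => s2 a b k)]
    funext x
    rw [pd_sum _ (fun a _ => ContDiff.sum fun b _ => s1 a b),
      pd_sum _ (fun a _ => ContDiff.sum fun b _ => ContDiff.sum fun k _ => s2 a b k)]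
    refine congrArg Neg.neg (congrArg₂ (fun a b : ℝ => a - b) ?_ ?_)
    · refine Finset.sum_congr rfl fun a _ => ?_
      rw [pd_sum _ (fun b _ => s1 a b)]
      refine Finset.sum_congr rfl fun b _ => ?_
      rw [pd_mul (hP.1 a b) ((h.pd b).pd a), pd_comm (h.pd b) i a, pd_comm h i b]
    · refine Finset.sum_congr rfl fun a _ => ?_
      rw [pd_sum _ (fun b _ => ContDiff.sum fun k _ => s2 a b k)]
      refine Finset.sum_congr rfl fun b _ => ?_
      rw [pd_sum _ (fun k _ => s2 a b k)]
      refine Finset.sum_congr rfl fun k _ => ?_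
      rw [pd_mul ((hP.1 a b).mul (hP.2 k a b)) (h.pd k), pd_comm h i k]
  funext x
  rw [e1]
  unfold lap
  simp only [Finset.sum_add_distrib]
  ring

/-! ### The calculus of controlled pairs -/

/-- `F - G` is controlled by `E` on `D`. -/
structure Ct (D : Set (Fin m → ℝ)) (E : (Fin m → ℝ) → ℝ) (F G : (Fin m → ℝ) → ℝ) : Prop where
  sF : Sm F
  sG : Sm G
  bd : ∃ C, 0 ≤ C ∧ ∀ x ∈ D, |F x - G x| ≤ C * E x

/-- `F - G` and its first derivatives are controlled by `E` on `D`. -/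
structure Ct1 (D : Set (Fin m → ℝ)) (E : (Fin m → ℝ) → ℝ) (F G : (Fin m → ℝ) → ℝ) : Prop where
  c : Ct D E F G
  d : ∀ i, Ct D E (fun x => pd i F x) (fun x => pd i G x)

variable {D : Set (Fin m → ℝ)} {E : (Fin m → ℝ) → ℝ} {F G F' G' : (Fin m → ℝ) → ℝ}

theorem Ct.refl (hE : ∀ x, 0 ≤ E x) (h : Sm F) : Ct D E F F :=
  ⟨h, h, 1, zero_le_one, fun x _ => by simpa using hE x⟩

theorem Ct1.refl (hE : ∀ x, 0 ≤ E x) (h : Sm F) : Ct1 D E F F :=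
  ⟨Ct.refl hE h, fun i => Ct.refl hE (h.pd i)⟩

theorem Ct.add (h : Ct D E F G) (h' : Ct D E F' G') :
    Ct D E (fun x => F x + F' x) (fun x => G x + G' x) := by
  obtain ⟨C, hC, hb⟩ := h.bd
  obtain ⟨C', hC', hb'⟩ := h'.bd
  refine ⟨h.sF.add h'.sF, h.sG.add h'.sG, C + C', by positivity, fun x hx => ?_⟩
  have := abs_add_le (F x - G x) (F' x - G' x)
  have := hb x hx
  have := hb' x hx
  rw [show F x + F' x - (G x + G' x) = (F x - G x) + (F' x - G' x) by ring]
  linarith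

theorem Ct.neg (h : Ct D E F G) : Ct D E (fun x => - F x) (fun x => - G x) := by
  obtain ⟨C, hC, hb⟩ := h.bd
  refine ⟨h.sF.neg, h.sG.neg, C, hC, fun x hx => ?_⟩
  rw [show - F x - - G x = -(F x - G x) by ring, abs_neg]
  exact hb x hx

theorem Ct.sub (h : Ct D E F G) (h' : Ct D E F' G') :
    Ct D E (fun x => F x - F' x) (fun x => G x - G' x) := by
  simpa only [sub_eq_add_neg] using h.add h'.neg

theorem Ct.sum (hE : ∀ x, 0 ≤ E x) {ι : Type} {s : Finset ι} {F G : ι → (Fin m → ℝ) → ℝ}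
    (h : ∀ a ∈ s, Ct D E (F a) (G a)) :
    Ct D E (fun x => ∑ a ∈ s, F a x) (fun x => ∑ a ∈ s, G a x) := by
  classical
  induction s using Finset.induction_on with
  | empty => simpa using Ct.refl hE contDiff_const
  | insert a s ha ih =>
    simp only [Finset.sum_insert ha]
    exact (h a (Finset.mem_insert_self a s)).add
      (ih fun b hb => h b (Finset.mem_insert_of_mem hb))

theorem bdd_of_cpt (hD : IsCompact (closure D)) (h : Sm F) : ∃ B, 0 ≤ B ∧ ∀ x ∈ D, |F x| ≤ B := by
  obtain ⟨B, hB⟩ := hD.exists_bound_of_continuousOn h.continuous.continuousOn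
  exact ⟨max B 0, le_max_right _ _, fun x hx => (hB x (subset_closure hx)).trans (le_max_left _ _)⟩

theorem Ct.mul (hD : IsCompact (closure D)) (h : Ct D E F G) (h' : Ct D E F' G') :
    Ct D E (fun x => F x * F' x) (fun x => G x * G' x) := by
  obtain ⟨C, hC, hb⟩ := h.bd
  obtain ⟨C', hC', hb'⟩ := h'.bd
  obtain ⟨B, hB, hbB⟩ := bdd_of_cpt hD h.sF
  obtain ⟨B', hB', hbB'⟩ := bdd_of_cpt hD h'.sG
  refine ⟨h.sF.mul h'.sF, h.sG.mul h'.sG, B * C' + C * B', by positivity, fun x hx => ?_⟩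
  rw [show F x * F' x - G x * G' x = F x * (F' x - G' x) + (F x - G x) * G' x by ring]
  calc _ ≤ |F x| * |F' x - G' x| + |F x - G x| * |G' x| := by
        rw [← abs_mul, ← abs_mul]; exact abs_add_le _ _
    _ ≤ B * (C' * E x) + (C * E x) * B' := by
        have h1 := hb x hx
        have h2 := hb' x hx
        have h3 := hbB x hx
        have h4 := hbB' x hx
        have := (abs_nonneg _).trans h1
        gcongr
    _ = _ := by ring

theorem Ct1.add (h : Ct1 D E F G) (h' : Ct1 D E F' G') :
    Ct1 D E (fun x => F x + F' x) (fun x => G x + G' x) := by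
  refine ⟨h.c.add h'.c, fun i => ?_⟩
  rw [pd_add h.c.sF h'.c.sF, pd_add h.c.sG h'.c.sG]
  exact (h.d i).add (h'.d i)

theorem Ct1.neg (h : Ct1 D E F G) : Ct1 D E (fun x => - F x) (fun x => - G x) := by
  refine ⟨h.c.neg, fun i => ?_⟩
  rw [pd_neg, pd_neg]
  exact (h.d i).neg

theorem Ct1.sub (h : Ct1 D E F G) (h' : Ct1 D E F' G') :
    Ct1 D E (fun x => F x - F' x) (fun x => G x - G' x) := by
  simpa only [sub_eq_add_neg] using h.add h'.neg

theorem Ct1.sum (hE : ∀ x, 0 ≤ E x) {ι : Type} {s : Finset ι} {F G : ι → (Fin m → ℝ) → ℝ}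
    (h : ∀ a ∈ s, Ct1 D E (F a) (G a)) :
    Ct1 D E (fun x => ∑ a ∈ s, F a x) (fun x => ∑ a ∈ s, G a x) := by
  refine ⟨Ct.sum hE fun a ha => (h a ha).c, fun i => ?_⟩
  rw [pd_sum s fun a ha => (h a ha).c.sF, pd_sum s fun a ha => (h a ha).c.sG]
  exact Ct.sum hE fun a ha => (h a ha).d i

theorem Ct1.mul (hD : IsCompact (closure D)) (h : Ct1 D E F G) (h' : Ct1 D E F' G') :
    Ct1 D E (fun x => F x * F' x) (fun x => G x * G' x) := by
  refine ⟨h.c.mul hD h'.c, fun i => ?_⟩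
  rw [pd_mul h.c.sF h'.c.sF, pd_mul h.c.sG h'.c.sG]
  exact (h.c.mul hD (h'.d i)).add ((h.d i).mul hD h'.c)

theorem Ct.comp (hE : ∀ x, 0 ≤ E x) (hD : IsCompact (closure D))
    {φ ψ : (Fin m → ℝ) → Fin n → ℝ}
    (hφ : ContDiff ℝ (⊤ : ℕ∞) φ) (hψ : ContDiff ℝ (⊤ : ℕ∞) ψ)
    (h0 : ∀ α, Ct D E (fun x => φ x α) (fun x => ψ x α))
    {h : (Fin n → ℝ) → ℝ} (hh : Sm h) :
    Ct D E (fun x => h (φ x)) (fun x => h (ψ x)) := by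
  refine ⟨hh.comp hφ, hh.comp hψ, ?_⟩
  obtain ⟨B, hB⟩ := hD.exists_bound_of_continuousOn hφ.continuous.continuousOn
  obtain ⟨B', hB'⟩ := hD.exists_bound_of_continuousOn hψ.continuous.continuousOn
  obtain ⟨K, hK⟩ := ContDiffOn.exists_lipschitzOnWith (s := Metric.closedBall 0 (max B B'))
    (hh.contDiffOn) (by simp) (convex_closedBall _ _) (isCompact_closedBall _ _)
  choose C hC hb using fun α => (h0 α).bd
  refine ⟨K * ∑ α, C α, mul_nonneg K.2 (Finset.sum_nonneg fun α _ => hC α), fun x hx => ?_⟩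
  have m1 : φ x ∈ Metric.closedBall (0 : Fin n → ℝ) (max B B') := by
    simpa using Or.inl (hB x (subset_closure hx))
  have m2 : ψ x ∈ Metric.closedBall (0 : Fin n → ℝ) (max B B') := by
    simpa using Or.inr (hB' x (subset_closure hx))
  have := hK.norm_sub_le m1 m2
  rw [Real.norm_eq_abs] at this
  refine this.trans ?_
  rw [mul_assoc]
  refine mul_le_mul_of_nonneg_left ?_ K.2
  refine (pi_norm_le_iff_of_nonneg
    (mul_nonneg (Finset.sum_nonneg fun α _ => hC α) (hE x))).2 fun α => ?_
  refine (hb α x hx).trans ?_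
  exact mul_le_mul_of_nonneg_right
    (Finset.single_le_sum (fun α _ => hC α) (Finset.mem_univ α)) (hE x)

theorem Ct1.comp (hE : ∀ x, 0 ≤ E x) (hD : IsCompact (closure D))
    {φ ψ : (Fin m → ℝ) → Fin n → ℝ}
    (hφ : ContDiff ℝ (⊤ : ℕ∞) φ) (hψ : ContDiff ℝ (⊤ : ℕ∞) ψ)
    (h0 : ∀ α, Ct1 D E (fun x => φ x α) (fun x => ψ x α))
    {h : (Fin n → ℝ) → ℝ} (hh : Sm h) :
    Ct1 D E (fun x => h (φ x)) (fun x => h (ψ x)) := by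
  refine ⟨Ct.comp hE hD hφ hψ (fun α => (h0 α).c) hh, fun i => ?_⟩
  rw [pd_comp hh hφ, pd_comp hh hψ]
  exact Ct.sum hE fun β _ =>
    (Ct.comp hE hD hφ hψ (fun α => (h0 α).c) (hh.pd β)).mul hD ((h0 β).d i)

theorem Ct.lap_pd {P : ChartData m n} (hP : P.SmoothDomain) (hE : ∀ x, 0 ≤ E x)
    (hD : IsCompact (closure D)) (h : Ct1 D E F G)
    (h2 : ∀ i, Ct1 D E (fun x => pd i F x) (fun x => pd i G x))
    (hl : Ct1 D E (fun x => lap P F x) (fun x => lap P G x)) (i : Fin m) :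
    Ct D E (fun x => lap P (fun z => pd i F z) x) (fun x => lap P (fun z => pd i G z) x) := by
  rw [Polyharm.lap_pd hP h.c.sF, Polyharm.lap_pd hP h.c.sG]
  refine (hl.d i).add (Ct.sub ?_ ?_)
  · exact Ct.sum hE fun a _ => Ct.sum hE fun b _ =>
      (Ct.refl hE (Sm.pd (hP.1 a b) i)).mul hD ((h2 b).d a)
  · exact Ct.sum hE fun a _ => Ct.sum hE fun b _ => Ct.sum hE fun k _ =>
      (Ct.refl hE (Sm.pd ((hP.1 a b).mul (hP.2 k a b)) i)).mul hD (h.d k)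

/-! ### Smoothness of the geometric quantities -/

theorem Sm.coord {φ : (Fin m → ℝ) → Fin n → ℝ} (hφ : ContDiff ℝ (⊤ : ℕ∞) φ) (α : Fin n) :
    Sm (fun x => φ x α) := contDiff_pi.1 hφ α

theorem Sm.dphi {φ : (Fin m → ℝ) → Fin n → ℝ} (hφ : ContDiff ℝ (⊤ : ℕ∞) φ) (i : Fin m)
    (α : Fin n) : Sm (fun x => dphi φ x i α) := (Sm.coord hφ α).pd i

theorem Sm.Scoef {P : ChartData m n} (hP : P.SmoothTarget) (α β ω ϑ : Fin n) :
    Sm (fun y => Scoef P y α β ω ϑ) := by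
  unfold Polyharm.Scoef
  refine ContDiff.div_const (ContDiff.add (ContDiff.add (ContDiff.add ?_ ?_) ?_) ?_) 2
  · exact Sm.pd (hP _ _ _) _
  · exact ContDiff.sum fun γ _ => (hP _ _ _).mul (hP _ _ _)
  · exact Sm.pd (hP _ _ _) _
  · exact ContDiff.sum fun γ _ => (hP _ _ _).mul (hP _ _ _)

theorem Sm.Rc {P : ChartData m n} (hP : P.SmoothTarget) (α δ β γ : Fin n) :
    Sm (fun y => Rc P y α δ β γ) := by
  unfold Polyharm.Rc
  refine ContDiff.add (ContDiff.sub ?_ ?_) ?_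
  · exact Sm.pd (hP _ _ _) _
  · exact Sm.pd (hP _ _ _) _
  · exact ContDiff.sum fun γ _ =>
      ((hP _ _ _).mul (hP _ _ _)).sub ((hP _ _ _).mul (hP _ _ _))

theorem Sm.tension {P : ChartData m n} (hP : P.SmoothDomain) (hP' : P.SmoothTarget)
    {φ : (Fin m → ℝ) → Fin n → ℝ} (hφ : ContDiff ℝ (⊤ : ℕ∞) φ) (α : Fin n) :
    Sm (fun x => tension P φ x α) := by
  unfold Polyharm.tension
  refine ContDiff.add (ContDiff.neg (Sm.lap hP (Sm.coord hφ α))) ?_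
  exact ContDiff.sum fun i _ => ContDiff.sum fun j _ => ContDiff.sum fun ϑ _ =>
    ContDiff.sum fun β _ => (((hP.1 i j).mul ((hP' α ϑ β).comp hφ)).mul
      (Sm.dphi hφ i ϑ)).mul (Sm.dphi hφ j β)

theorem Sm.Asec {P : ChartData m n} (hP : P.SmoothDomain) (hP' : P.SmoothTarget)
    {φ σ : (Fin m → ℝ) → Fin n → ℝ} (hφ : ContDiff ℝ (⊤ : ℕ∞) φ)
    (hσ : ∀ α, Sm (fun x => σ x α)) (α : Fin n) :
    Sm (fun x => Asec P φ σ x α) := by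
  unfold Polyharm.Asec Polyharm.Aop
  refine ContDiff.add ?_ ?_
  · exact ContDiff.sum fun ϑ _ => ContDiff.sum fun i _ => (Sm.pd (hσ ϑ) i).mul
      (contDiff_const.mul (ContDiff.sum fun j _ => ContDiff.sum fun β _ =>
        ((hP.1 i j).mul (Sm.dphi hφ j β)).mul ((hP' α β ϑ).comp hφ)))
  · exact ContDiff.sum fun ϑ _ => (hσ ϑ).mul (ContDiff.sub
      (ContDiff.sum fun β _ => (Sm.lap hP (Sm.coord hφ β)).mul ((hP' α β ϑ).comp hφ))
      (ContDiff.sum fun i _ => ContDiff.sum fun j _ => ContDiff.sum fun β _ =>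
        ContDiff.sum fun ω _ => (((hP.1 i j).mul (Sm.dphi hφ j β)).mul
          (Sm.dphi hφ i ω)).mul ((Sm.Scoef hP' α β ω ϑ).comp hφ)))

theorem Sm.uvar {P : ChartData m n} (hP : P.SmoothDomain) (hP' : P.SmoothTarget)
    {φ : (Fin m → ℝ) → Fin n → ℝ} (hφ : ContDiff ℝ (⊤ : ℕ∞) φ) (l : ℕ) :
    ∀ α, Sm (fun x => uvar P φ l x α) := by
  induction l with
  | zero => exact fun α => Sm.tension hP hP' hφ α
  | succ l ih => exact fun α => (Sm.lap hP (ih α)).add (Sm.Asec hP hP' hφ ih α)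

/-! ### Control of the geometric quantities -/

section control

variable {P : ChartData m n} {φ ψ : (Fin m → ℝ) → Fin n → ℝ}

theorem Ct.Asec (hE : ∀ x, 0 ≤ E x) (hD : IsCompact (closure D))
    (hP : P.SmoothDomain) (hP' : P.SmoothTarget)
    (hφ : ContDiff ℝ (⊤ : ℕ∞) φ) (hψ : ContDiff ℝ (⊤ : ℕ∞) ψ)
    (h0 : ∀ α, Ct D E (fun x => φ x α) (fun x => ψ x α))
    (h1 : ∀ i α, Ct D E (fun x => dphi φ x i α) (fun x => dphi ψ x i α))
    (hl : ∀ α, Ct D E (fun x => lap P (fun z => φ z α) x) (fun x => lap P (fun z => ψ z α) x))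
    {σ ρ : (Fin m → ℝ) → Fin n → ℝ}
    (hs : ∀ α, Ct D E (fun x => σ x α) (fun x => ρ x α))
    (hds : ∀ i α, Ct D E (fun x => pd i (fun z => σ z α) x) (fun x => pd i (fun z => ρ z α) x))
    (α : Fin n) :
    Ct D E (fun x => Asec P φ σ x α) (fun x => Asec P ψ ρ x α) := by
  have hc : ∀ {h : (Fin n → ℝ) → ℝ}, Sm h → Ct D E (fun x => h (φ x)) (fun x => h (ψ x)) :=
    fun hh => Ct.comp hE hD hφ hψ h0 hh
  unfold Polyharm.Asec Polyharm.Aop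
  refine Ct.add ?_ ?_
  · exact Ct.sum hE fun ϑ _ => Ct.sum hE fun i _ => (hds i ϑ).mul hD
      ((Ct.refl hE contDiff_const).mul hD (Ct.sum hE fun j _ => Ct.sum hE fun β _ =>
        ((Ct.refl hE (hP.1 i j)).mul hD (h1 j β)).mul hD (hc (hP' α β ϑ))))
  · exact Ct.sum hE fun ϑ _ => (hs ϑ).mul hD (Ct.sub
      (Ct.sum hE fun β _ => (hl β).mul hD (hc (hP' α β ϑ)))
      (Ct.sum hE fun i _ => Ct.sum hE fun j _ => Ct.sum hE fun β _ =>
        Ct.sum hE fun ω _ => (((Ct.refl hE (hP.1 i j)).mul hD (h1 j β)).mul hD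
          (h1 i ω)).mul hD (hc (Sm.Scoef hP' α β ω ϑ))))

theorem Ct1.Asec (hE : ∀ x, 0 ≤ E x) (hD : IsCompact (closure D))
    (hP : P.SmoothDomain) (hP' : P.SmoothTarget)
    (hφ : ContDiff ℝ (⊤ : ℕ∞) φ) (hψ : ContDiff ℝ (⊤ : ℕ∞) ψ)
    (h0 : ∀ α, Ct1 D E (fun x => φ x α) (fun x => ψ x α))
    (h1 : ∀ i α, Ct1 D E (fun x => dphi φ x i α) (fun x => dphi ψ x i α))
    (hl : ∀ α, Ct1 D E (fun x => lap P (fun z => φ z α) x) (fun x => lap P (fun z => ψ z α) x))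
    {σ ρ : (Fin m → ℝ) → Fin n → ℝ}
    (hs : ∀ α, Ct1 D E (fun x => σ x α) (fun x => ρ x α))
    (hds : ∀ i α, Ct1 D E (fun x => pd i (fun z => σ z α) x) (fun x => pd i (fun z => ρ z α) x))
    (α : Fin n) :
    Ct1 D E (fun x => Asec P φ σ x α) (fun x => Asec P ψ ρ x α) := by
  have hc : ∀ {h : (Fin n → ℝ) → ℝ}, Sm h → Ct1 D E (fun x => h (φ x)) (fun x => h (ψ x)) :=
    fun hh => Ct1.comp hE hD hφ hψ h0 hh
  unfold Polyharm.Asec Polyharm.Aop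
  refine Ct1.add ?_ ?_
  · exact Ct1.sum hE fun ϑ _ => Ct1.sum hE fun i _ => (hds i ϑ).mul hD
      ((Ct1.refl hE contDiff_const).mul hD (Ct1.sum hE fun j _ => Ct1.sum hE fun β _ =>
        ((Ct1.refl hE (hP.1 i j)).mul hD (h1 j β)).mul hD (hc (hP' α β ϑ))))
  · exact Ct1.sum hE fun ϑ _ => (hs ϑ).mul hD (Ct1.sub
      (Ct1.sum hE fun β _ => (hl β).mul hD (hc (hP' α β ϑ)))
      (Ct1.sum hE fun i _ => Ct1.sum hE fun j _ => Ct1.sum hE fun β _ =>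
        Ct1.sum hE fun ω _ => (((Ct1.refl hE (hP.1 i j)).mul hD (h1 j β)).mul hD
          (h1 i ω)).mul hD (hc (Sm.Scoef hP' α β ω ϑ))))

/-- The Laplacian of `φ` in terms of the tension field. -/
theorem Ct1.lapφ (hE : ∀ x, 0 ≤ E x) (hD : IsCompact (closure D))
    (hP : P.SmoothDomain) (hP' : P.SmoothTarget)
    (hφ : ContDiff ℝ (⊤ : ℕ∞) φ) (hψ : ContDiff ℝ (⊤ : ℕ∞) ψ)
    (h0 : ∀ α, Ct1 D E (fun x => φ x α) (fun x => ψ x α))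
    (h1 : ∀ i α, Ct1 D E (fun x => dphi φ x i α) (fun x => dphi ψ x i α))
    (hu : ∀ α, Ct1 D E (fun x => uvar P φ 0 x α) (fun x => uvar P ψ 0 x α)) (α : Fin n) :
    Ct1 D E (fun x => lap P (fun z => φ z α) x) (fun x => lap P (fun z => ψ z α) x) := by
  have hc : ∀ {h : (Fin n → ℝ) → ℝ}, Sm h → Ct1 D E (fun x => h (φ x)) (fun x => h (ψ x)) :=
    fun hh => Ct1.comp hE hD hφ hψ h0 hh
  have e : ∀ χ : (Fin m → ℝ) → Fin n → ℝ, (fun x => lap P (fun z => χ z α) x) = fun x =>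
      (∑ i, ∑ j, ∑ ϑ, ∑ β,
        P.ginv x i j * P.ΓN (χ x) α ϑ β * dphi χ x i ϑ * dphi χ x j β) - uvar P χ 0 x α := by
    intro χ
    funext x
    simp only [uvar, tension]
    ring
  rw [e φ, e ψ]
  exact Ct1.sub (Ct1.sum hE fun i _ => Ct1.sum hE fun j _ => Ct1.sum hE fun ϑ _ =>
    Ct1.sum hE fun β _ => (((Ct1.refl hE (hP.1 i j)).mul hD (hc (hP' α ϑ β))).mul hD
      (h1 i ϑ)).mul hD (h1 j β)) (hu α)

theorem Ct.cov_deriv (hE : ∀ x, 0 ≤ E x) (hD : IsCompact (closure D))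
    (hP' : P.SmoothTarget)
    (hφ : ContDiff ℝ (⊤ : ℕ∞) φ) (hψ : ContDiff ℝ (⊤ : ℕ∞) ψ)
    (h0 : ∀ α, Ct D E (fun x => φ x α) (fun x => ψ x α))
    (h1 : ∀ i α, Ct D E (fun x => dphi φ x i α) (fun x => dphi ψ x i α))
    {σ ρ : (Fin m → ℝ) → Fin n → ℝ} (hs : ∀ α, Ct1 D E (fun x => σ x α) (fun x => ρ x α))
    (i : Fin m) (α : Fin n) :
    Ct D E (fun x => covD P φ σ i x α) (fun x => covD P ψ ρ i x α) := by
  unfold Polyharm.covD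
  exact ((hs α).d i).add (Ct.sum hE fun β _ => Ct.sum hE fun δ _ =>
    ((Ct.comp hE hD hφ hψ h0 (hP' α β δ)).mul hD (h1 i β)).mul hD (hs δ).c)

theorem Ct.tr (hE : ∀ x, 0 ≤ E x) (hD : IsCompact (closure D))
    (hP : P.SmoothDomain) (hP' : P.SmoothTarget)
    (hφ : ContDiff ℝ (⊤ : ℕ∞) φ) (hψ : ContDiff ℝ (⊤ : ℕ∞) ψ)
    (h0 : ∀ α, Ct D E (fun x => φ x α) (fun x => ψ x α))
    {W W' Z Z' V V' : Fin m → Fin m → Fin n → (Fin m → ℝ) → ℝ}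
    (hW : ∀ i j α, Ct D E (fun x => W i j α x) (fun x => W' i j α x))
    (hZ : ∀ i j α, Ct D E (fun x => Z i j α x) (fun x => Z' i j α x))
    (hV : ∀ i j α, Ct D E (fun x => V i j α x) (fun x => V' i j α x)) (α : Fin n) :
    Ct D E (fun x => ∑ i, ∑ j, ∑ β, ∑ γ, ∑ δ,
        P.ginv x i j * Rc P (φ x) α δ β γ * W i j β x * Z i j γ x * V i j δ x)
      (fun x => ∑ i, ∑ j, ∑ β, ∑ γ, ∑ δ,
        P.ginv x i j * Rc P (ψ x) α δ β γ * W' i j β x * Z' i j γ x * V' i j δ x) :=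
  Ct.sum hE fun i _ => Ct.sum hE fun j _ => Ct.sum hE fun β _ => Ct.sum hE fun γ _ =>
    Ct.sum hE fun δ _ => ((((Ct.refl hE (hP.1 i j)).mul hD
      (Ct.comp hE hD hφ hψ h0 (Sm.Rc hP' α δ β γ))).mul hD (hW i j β)).mul hD
        (hZ i j γ)).mul hD (hV i j δ)

theorem Ct.utop (hE : ∀ x, 0 ≤ E x) (hD : IsCompact (closure D))
    (hP : P.SmoothDomain) (hP' : P.SmoothTarget)
    (hφ : ContDiff ℝ (⊤ : ℕ∞) φ) (hψ : ContDiff ℝ (⊤ : ℕ∞) ψ)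
    (h0 : ∀ α, Ct D E (fun x => φ x α) (fun x => ψ x α))
    (h1 : ∀ i α, Ct D E (fun x => dphi φ x i α) (fun x => dphi ψ x i α))
    (k : ℕ) (hk : 3 ≤ k)
    (hpolyφ : ∀ (x : Fin m → ℝ) (α : Fin n), tauK P φ k x α = 0)
    (hpolyψ : ∀ (x : Fin m → ℝ) (α : Fin n), tauK P ψ k x α = 0)
    (hu : ∀ l, l ≤ k - 2 → ∀ α,
      Ct1 D E (fun x => uvar P φ l x α) (fun x => uvar P ψ l x α)) (α : Fin n) :
    Ct D E (fun x => uvar P φ (k-1) x α) (fun x => uvar P ψ (k-1) x α) := by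
  have hcov : ∀ l, l ≤ k - 2 → ∀ i α,
      Ct D E (fun x => covD P φ (uvar P φ l) i x α) (fun x => covD P ψ (uvar P ψ l) i x α) :=
    fun l hl i α => Ct.cov_deriv hE hD hP' hφ hψ h0 h1 (hu l hl) i α
  have t1 : Ct D E (fun x => trRphi P φ (uvar P φ (k-2)) x α)
      (fun x => trRphi P ψ (uvar P ψ (k-2)) x α) :=
    Ct.tr hE hD hP hP' hφ hψ h0 (fun _ _ α => (hu (k-2) le_rfl α).c) (fun i _ α => h1 i α)
      (fun _ j α => h1 j α) α
  have t2 : ∀ a b, a ≤ k - 2 → b ≤ k - 2 → Ct D E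
      (fun x => trRD P φ (uvar P φ a) (uvar P φ b) x α)
      (fun x => trRD P ψ (uvar P ψ a) (uvar P ψ b) x α) := fun a b ha hb =>
    Ct.tr hE hD hP hP' hφ hψ h0 (fun i _ α => hcov a ha i α) (fun _ _ α => (hu b hb α).c)
      (fun _ j α => h1 j α) α
  have t3 : ∀ a b, a ≤ k - 2 → b ≤ k - 2 → Ct D E
      (fun x => trRD2 P φ (uvar P φ a) (uvar P φ b) x α)
      (fun x => trRD2 P ψ (uvar P ψ a) (uvar P ψ b) x α) := fun a b ha hb =>
    Ct.tr hE hD hP hP' hφ hψ h0 (fun _ _ α => (hu a ha α).c) (fun i _ α => hcov b hb i α)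
      (fun _ j α => h1 j α) α
  by_cases hev : Even k
  · have e : ∀ χ : (Fin m → ℝ) → Fin n → ℝ, (∀ x α, tauK P χ k x α = 0) →
        (fun x => uvar P χ (k-1) x α) = fun x => trRphi P χ (uvar P χ (k-2)) x α
      + ∑ ℓ ∈ Finset.Icc 1 (k/2 - 1),
          (trRD P χ (uvar P χ (k/2 + ℓ - 2)) (uvar P χ (k/2 - ℓ - 1)) x α
            - trRD2 P χ (uvar P χ (k/2 + ℓ - 2)) (uvar P χ (k/2 - ℓ - 1)) x α) := by
      intro χ hχ
      funext x
      have := hχ x α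
      rw [tauK, if_pos hev] at this
      linarith
    rw [e φ hpolyφ, e ψ hpolyψ]
    refine t1.add (Ct.sum hE fun l hl => ?_)
    rw [Finset.mem_Icc] at hl
    exact (t2 _ _ (by omega) (by omega)).sub (t3 _ _ (by omega) (by omega))
  · have e : ∀ χ : (Fin m → ℝ) → Fin n → ℝ, (∀ x α, tauK P χ k x α = 0) →
        (fun x => uvar P χ (k-1) x α) = fun x => trRphi P χ (uvar P χ (k-2)) x α
      + (∑ ℓ ∈ Finset.Icc 1 (k/2 - 1),
          (trRD P χ (uvar P χ (k/2 + ℓ - 1)) (uvar P χ (k/2 - ℓ - 1)) x α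
            - trRD2 P χ (uvar P χ (k/2 + ℓ - 1)) (uvar P χ (k/2 - ℓ - 1)) x α))
      + trRD P χ (uvar P χ (k/2 - 1)) (uvar P χ (k/2 - 1)) x α := by
      intro χ hχ
      funext x
      have := hχ x α
      rw [tauK, if_neg hev] at this
      linarith
    rw [e φ hpolyφ, e ψ hpolyψ]
    refine (t1.add (Ct.sum hE fun l hl => ?_)).add (t2 _ _ (by omega) (by omega))
    rw [Finset.mem_Icc] at hl
    exact (t2 _ _ (by omega) (by omega)).sub (t3 _ _ (by omega) (by omega))

end control

/-! ### Norms -/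

theorem vnorm_nonneg {ι : Type} [Fintype ι] (f : ι → ℝ) : 0 ≤ vnorm f := Real.sqrt_nonneg _

theorem le_vnorm {ι : Type} [Fintype ι] (f : ι → ℝ) (i : ι) : |f i| ≤ vnorm f := by
  refine Real.abs_le_sqrt ?_
  exact Finset.single_le_sum (f := fun i => f i ^ 2) (fun _ _ => sq_nonneg _) (Finset.mem_univ i)

/-- `S` is bounded by a multiple of `E²` on `D`. -/
def Qd (D : Set (Fin m → ℝ)) (E : (Fin m → ℝ) → ℝ) (S : (Fin m → ℝ) → ℝ) : Prop :=
  ∃ C, 0 ≤ C ∧ ∀ x ∈ D, S x ≤ C * E x ^ 2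

theorem Qd.add (h : Qd D E F) (h' : Qd D E G) : Qd D E (fun x => F x + G x) := by
  obtain ⟨C, hC, hb⟩ := h
  obtain ⟨C', hC', hb'⟩ := h'
  refine ⟨C + C', by positivity, fun x hx => ?_⟩
  have := hb x hx
  have := hb' x hx
  linarith

theorem Qd.sum {ι : Type} {s : Finset ι} {F : ι → (Fin m → ℝ) → ℝ}
    (h : ∀ a ∈ s, Qd D E (F a)) : Qd D E (fun x => ∑ a ∈ s, F a x) := by
  classical
  induction s using Finset.induction_on with
  | empty => exact ⟨0, le_rfl, fun x _ => by simp⟩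
  | insert a s ha ih =>
    simp only [Finset.sum_insert ha]
    exact (h a (Finset.mem_insert_self a s)).add
      (ih fun b hb => h b (Finset.mem_insert_of_mem hb))

theorem Qd.lap {P : ChartData m n} (hF : Sm F) (hG : Sm G)
    (h : Ct D E (fun x => lap P F x) (fun x => lap P G x)) :
    Qd D E (fun x => (lap P (fun z => F z - G z) x) ^ 2) := by
  obtain ⟨C, hC, hb⟩ := h.bd
  refine ⟨C ^ 2, by positivity, fun x hx => ?_⟩
  beta_reduce
  rw [lap_sub hF hG, ← mul_pow, ← sq_abs]
  exact pow_le_pow_left₀ (abs_nonneg _) (hb x hx) 2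

theorem Qd.sqrt (hE : ∀ x, 0 ≤ E x) {S : (Fin m → ℝ) → ℝ} (h : Qd D E S) :
    ∃ C > 0, ∀ x ∈ D, Real.sqrt (S x) ≤ C * E x := by
  obtain ⟨C, hC, hb⟩ := h
  refine ⟨Real.sqrt C + 1, by positivity, fun x hx => ?_⟩
  calc Real.sqrt (S x) ≤ Real.sqrt (C * E x ^ 2) := Real.sqrt_le_sqrt (hb x hx)
    _ = Real.sqrt C * E x := by rw [Real.sqrt_mul hC, Real.sqrt_sq (hE x)]
    _ ≤ _ := by nlinarith [hE x]

theorem Ct.of_le (hF : Sm F) (hG : Sm G) (h : ∀ x, |F x - G x| ≤ E x) : Ct D E F G :=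
  ⟨hF, hG, 1, zero_le_one, fun x _ => by simpa using h x⟩

/-- The abstract estimate. -/
theorem main_abstract
    (P : ChartData m n)
    (hP : P.SmoothDomain) (hP' : P.SmoothTarget)
    (φ ψ : (Fin m → ℝ) → Fin n → ℝ)
    (hφ : ContDiff ℝ (⊤ : ℕ∞) φ) (hψ : ContDiff ℝ (⊤ : ℕ∞) ψ)
    (k : ℕ) (hk : 3 ≤ k)
    (hpolyφ : ∀ (x : Fin m → ℝ) (α : Fin n), tauK P φ k x α = 0)
    (hpolyψ : ∀ (x : Fin m → ℝ) (α : Fin n), tauK P ψ k x α = 0)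
    (D : Set (Fin m → ℝ)) (hD : IsCompact (closure D))
    (E : (Fin m → ℝ) → ℝ) (hE : ∀ x, 0 ≤ E x)
    (b0 : ∀ x α, |φ x α - ψ x α| ≤ E x)
    (b1 : ∀ x i α, |dphi φ x i α - dphi ψ x i α| ≤ E x)
    (b2 : ∀ x i j α, |sff P φ x i j α - sff P ψ x i j α| ≤ E x)
    (bu : ∀ l ≤ k - 2, ∀ x α, |uvar P φ l x α - uvar P ψ l x α| ≤ E x)
    (bv : ∀ l ≤ k - 2, ∀ x i α, |vvar P φ l x i α - vvar P ψ l x i α| ≤ E x)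
    (bw : ∀ l ≤ k - 3, ∀ x i j α, |pd i (fun z => vvar P φ l z j α) x
      - pd i (fun z => vvar P ψ l z j α) x| ≤ E x) :
    ∃ C > 0, ∀ x ∈ D,
      Real.sqrt ((∑ α, (lap P (fun z => φ z α - ψ z α) x) ^ 2)
          + (∑ i, ∑ α, (lap P (fun z => dphi φ z i α - dphi ψ z i α) x) ^ 2)
          + (∑ l ∈ Finset.range (k-1), ∑ α,
              (lap P (fun z => uvar P φ l z α - uvar P ψ l z α) x) ^ 2)
          + ∑ l ∈ Finset.range (k-2), ∑ i, ∑ α,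
              (lap P (fun z => vvar P φ l z i α - vvar P ψ l z i α) x) ^ 2) ≤ C * E x := by
  have sφ := Sm.coord hφ
  have sψ := Sm.coord hψ
  have suφ := Sm.uvar hP hP' hφ
  have suψ := Sm.uvar hP hP' hψ
  have c1 : ∀ i α, Ct D E (fun x => dphi φ x i α) (fun x => dphi ψ x i α) := fun i α =>
    Ct.of_le (Sm.dphi hφ i α) (Sm.dphi hψ i α) fun x => b1 x i α
  have h0 : ∀ α, Ct1 D E (fun x => φ x α) (fun x => ψ x α) := fun α =>
    ⟨Ct.of_le (sφ α) (sψ α) fun x => b0 x α, fun i => c1 i α⟩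
  have hc : ∀ {h : (Fin n → ℝ) → ℝ}, Sm h → Ct D E (fun x => h (φ x)) (fun x => h (ψ x)) :=
    fun hh => Ct.comp hE hD hφ hψ (fun α => (h0 α).c) hh
  have e2 : ∀ χ : (Fin m → ℝ) → Fin n → ℝ, ∀ i j α, (fun x => pd i (fun z => dphi χ z j α) x)
      = fun x => (sff P χ x i j α + ∑ k, P.ΓM x k i j * dphi χ x k α)
        - ∑ β, ∑ γ, P.ΓN (χ x) α β γ * dphi χ x i β * dphi χ x j γ := by
    intro χ i j α
    funext x
    unfold sff
    ring
  have ssff : ∀ χ : (Fin m → ℝ) → Fin n → ℝ, ContDiff ℝ (⊤ : ℕ∞) χ → ∀ i j α,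
      Sm (fun x => sff P χ x i j α) := by
    intro χ hχ i j α
    unfold sff
    exact ContDiff.add (ContDiff.sub (Sm.pd (Sm.dphi hχ j α) i)
      (ContDiff.sum fun k _ => (hP.2 k i j).mul (Sm.dphi hχ k α)))
      (ContDiff.sum fun β _ => ContDiff.sum fun γ _ =>
        (((hP' α β γ).comp hχ).mul (Sm.dphi hχ i β)).mul (Sm.dphi hχ j γ))
  have h1 : ∀ i α, Ct1 D E (fun x => dphi φ x i α) (fun x => dphi ψ x i α) := by
    refine fun j α => ⟨c1 j α, fun i => ?_⟩
    rw [e2 φ, e2 ψ]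
    refine Ct.sub (Ct.add (Ct.of_le (ssff φ hφ i j α) (ssff ψ hψ i j α) fun x => b2 x i j α) ?_) ?_
    · exact Ct.sum hE fun k _ => (Ct.refl hE (hP.2 k i j)).mul hD (c1 k α)
    · exact Ct.sum hE fun β _ => Ct.sum hE fun γ _ =>
        ((hc (hP' α β γ)).mul hD (c1 i β)).mul hD (c1 j γ)
  have hu : ∀ l ≤ k - 2, ∀ α, Ct1 D E (fun x => uvar P φ l x α) (fun x => uvar P ψ l x α) :=
    fun l hl α => ⟨Ct.of_le (suφ l α) (suψ l α) fun x => bu l hl x α, fun i =>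
      Ct.of_le ((suφ l α).pd i) ((suψ l α).pd i) fun x => bv l hl x i α⟩
  have hv : ∀ l ≤ k - 3, ∀ i α, Ct1 D E (fun x => pd i (fun z => uvar P φ l z α) x)
      (fun x => pd i (fun z => uvar P ψ l z α) x) :=
    fun l hl i α => ⟨(hu l (by omega) α).d i, fun j =>
      Ct.of_le (((suφ l α).pd i).pd j) (((suψ l α).pd i).pd j) fun x => bw l hl x j i α⟩
  have hlφ := Ct1.lapφ hE hD hP hP' hφ hψ h0 h1 (hu 0 (by omega))
  have eu : ∀ χ : (Fin m → ℝ) → Fin n → ℝ, ∀ l α, (fun x => lap P (fun z => uvar P χ l z α) x)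
      = fun x => uvar P χ (l+1) x α - Asec P χ (uvar P χ l) x α := by
    intro χ l α
    funext x
    simp only [uvar]
    ring
  have hlu : ∀ l ≤ k - 3, ∀ α, Ct1 D E (fun x => lap P (fun z => uvar P φ l z α) x)
      (fun x => lap P (fun z => uvar P ψ l z α) x) := by
    intro l hl α
    rw [eu φ, eu ψ]
    exact (hu (l+1) (by omega) α).sub
      (Ct1.Asec hE hD hP hP' hφ hψ h0 h1 hlφ (hu l (by omega)) (hv l hl) α)
  have hlu' : ∀ l ≤ k - 2, ∀ α, Ct D E (fun x => lap P (fun z => uvar P φ l z α) x)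
      (fun x => lap P (fun z => uvar P ψ l z α) x) := by
    intro l hl α
    by_cases hl' : l ≤ k - 3
    · exact (hlu l hl' α).c
    · have hlk : l + 1 = k - 1 := by omega
      rw [eu φ, eu ψ, hlk]
      exact (Ct.utop hE hD hP hP' hφ hψ (fun α => (h0 α).c) c1 k hk hpolyφ hpolyψ hu α).sub
        (Ct.Asec hE hD hP hP' hφ hψ (fun α => (h0 α).c) c1 (fun α => (hlφ α).c)
          (fun α => (hu l hl α).c) (fun i α => (hu l hl α).d i) α)
  refine Qd.sqrt hE (Qd.add (Qd.add (Qd.add ?_ ?_) ?_) ?_)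
  · exact Qd.sum fun α _ => Qd.lap (sφ α) (sψ α) (hlφ α).c
  · exact Qd.sum fun i _ => Qd.sum fun α _ => Qd.lap (Sm.dphi hφ i α) (Sm.dphi hψ i α)
      (Ct.lap_pd hP hE hD (h0 α) (fun i => h1 i α) (hlφ α) i)
  · refine Qd.sum fun l hl => Qd.sum fun α _ => Qd.lap (suφ l α) (suψ l α) (hlu' l ?_ α)
    rw [Finset.mem_range] at hl
    omega
  · refine Qd.sum fun l hl => Qd.sum fun i _ => Qd.sum fun α _ =>
      Qd.lap ((suφ l α).pd i) ((suψ l α).pd i) ?_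
    rw [Finset.mem_range] at hl
    exact Ct.lap_pd hP hE hD (hu l (by omega) α) (fun i => hv l (by omega) i α)
      (hlu l (by omega) α) i

theorem le_six {a b c d e f t : ℝ} (ha : 0 ≤ a) (hb : 0 ≤ b) (hc : 0 ≤ c) (hd : 0 ≤ d)
    (he : 0 ≤ e) (hf : 0 ≤ f)
    (h : t ≤ a ∨ t ≤ b ∨ t ≤ c ∨ t ≤ d ∨ t ≤ e ∨ t ≤ f) : t ≤ a + b + c + d + e + f := by
  rcases h with h | h | h | h | h | h <;> linarith

/-- (Estimate (2.23) of the paper.)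
Let `φ, φ̃ : M → N` be two polyharmonic maps of order `k ≥ 3` and let
`z = (φ-φ̃, dφ-dφ̃, u₀-ũ₀, v₀-ṽ₀, …, v_{k-3}-ṽ_{k-3}, u_{k-2}-ũ_{k-2})`. Then on any
open set `D` with compact closure contained in the chart domain `U` there exists
`C > 0` with
`|Δz| ≤ C( |φ-φ̃| + |dφ-dφ̃| + |∇dφ-∇dφ̃| + Σ_{ℓ=0}^{k-2}|u_ℓ-ũ_ℓ|
  + Σ_{ℓ=0}^{k-3}(|v_ℓ-ṽ_ℓ| + |∇v_ℓ-∇ṽ_ℓ|) + |∇u_{k-2}-∇ũ_{k-2}| )`,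
where `Δ` acts componentwise. -/
theorem estimate_full_Delta_z
    {m n : ℕ} (P : ChartData m n)
    (hPdom : P.SmoothDomain) (hPtar : P.SmoothTarget) (hPriem : P.Riemannian)
    (U : Set (Fin m → ℝ)) (hUopen : IsOpen U)
    (φ ψ : (Fin m → ℝ) → Fin n → ℝ)
    (hφ : ContDiff ℝ (⊤ : ℕ∞) φ) (hψ : ContDiff ℝ (⊤ : ℕ∞) ψ)
    (k : ℕ) (hk : 3 ≤ k)
    (hpolyφ : ∀ (x : Fin m → ℝ) (α : Fin n), tauK P φ k x α = 0)
    (hpolyψ : ∀ (x : Fin m → ℝ) (α : Fin n), tauK P ψ k x α = 0)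
    (D : Set (Fin m → ℝ)) (hDopen : IsOpen D) (hDcpt : IsCompact (closure D))
    (hDsub : closure D ⊆ U) :
    ∃ C > 0, ∀ x ∈ D,
      Real.sqrt ((∑ α, (lap P (fun z => φ z α - ψ z α) x) ^ 2)
          + (∑ i, ∑ α, (lap P (fun z => dphi φ z i α - dphi ψ z i α) x) ^ 2)
          + (∑ l ∈ Finset.range (k-1), ∑ α,
              (lap P (fun z => uvar P φ l z α - uvar P ψ l z α) x) ^ 2)
          + ∑ l ∈ Finset.range (k-2), ∑ i, ∑ α,
              (lap P (fun z => vvar P φ l z i α - vvar P ψ l z i α) x) ^ 2)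
        ≤ C * (vnorm (fun α : Fin n => φ x α - ψ x α)
          + vnorm (fun p : Fin m × Fin n => dphi φ x p.1 p.2 - dphi ψ x p.1 p.2)
          + vnorm (fun p : Fin m × Fin m × Fin n =>
              sff P φ x p.1 p.2.1 p.2.2 - sff P ψ x p.1 p.2.1 p.2.2)
          + (∑ l ∈ Finset.range (k-1),
              vnorm (fun α : Fin n => uvar P φ l x α - uvar P ψ l x α))
          + (∑ l ∈ Finset.range (k-2),
              (vnorm (fun p : Fin m × Fin n =>
                  vvar P φ l x p.1 p.2 - vvar P ψ l x p.1 p.2)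
                + vnorm (fun p : Fin m × Fin m × Fin n =>
                    pd p.1 (fun z => vvar P φ l z p.2.1 p.2.2) x
                      - pd p.1 (fun z => vvar P ψ l z p.2.1 p.2.2) x)))
          + vnorm (fun p : Fin m × Fin n =>
              vvar P φ (k-2) x p.1 p.2 - vvar P ψ (k-2) x p.1 p.2)) := by
  have t4 : ∀ x, 0 ≤ ∑ l ∈ Finset.range (k-1),
      vnorm (fun α : Fin n => uvar P φ l x α - uvar P ψ l x α) :=
    fun x => Finset.sum_nonneg fun l _ => vnorm_nonneg _
  have t5 : ∀ x, 0 ≤ ∑ l ∈ Finset.range (k-2),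
              (vnorm (fun p : Fin m × Fin n =>
                  vvar P φ l x p.1 p.2 - vvar P ψ l x p.1 p.2)
                + vnorm (fun p : Fin m × Fin m × Fin n =>
                    pd p.1 (fun z => vvar P φ l z p.2.1 p.2.2) x
                      - pd p.1 (fun z => vvar P ψ l z p.2.1 p.2.2) x)) :=
    fun x => Finset.sum_nonneg fun l _ => add_nonneg (vnorm_nonneg _) (vnorm_nonneg _)
  have n1 := fun x => vnorm_nonneg (fun α : Fin n => φ x α - ψ x α)
  have n2 := fun x => vnorm_nonneg
    (fun p : Fin m × Fin n => dphi φ x p.1 p.2 - dphi ψ x p.1 p.2)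
  have n3 := fun x => vnorm_nonneg (fun p : Fin m × Fin m × Fin n =>
              sff P φ x p.1 p.2.1 p.2.2 - sff P ψ x p.1 p.2.1 p.2.2)
  have n6 := fun x => vnorm_nonneg (fun p : Fin m × Fin n =>
              vvar P φ (k-2) x p.1 p.2 - vvar P ψ (k-2) x p.1 p.2)
  have m4 : ∀ l ≤ k - 2, ∀ x, vnorm (fun α : Fin n => uvar P φ l x α - uvar P ψ l x α) ≤ _ :=
    fun l hl x => Finset.single_le_sum
      (f := fun l => vnorm (fun α : Fin n => uvar P φ l x α - uvar P ψ l x α))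
      (fun l _ => vnorm_nonneg _) (Finset.mem_range.2 (by omega : l < k - 1))
  have m5 : ∀ l ≤ k - 3, ∀ x, (vnorm (fun p : Fin m × Fin n =>
                  vvar P φ l x p.1 p.2 - vvar P ψ l x p.1 p.2)
                + vnorm (fun p : Fin m × Fin m × Fin n =>
                    pd p.1 (fun z => vvar P φ l z p.2.1 p.2.2) x
                      - pd p.1 (fun z => vvar P ψ l z p.2.1 p.2.2) x)) ≤ _ :=
    fun l hl x => Finset.single_le_sum
      (f := fun l => (vnorm (fun p : Fin m × Fin n =>
                  vvar P φ l x p.1 p.2 - vvar P ψ l x p.1 p.2)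
                + vnorm (fun p : Fin m × Fin m × Fin n =>
                    pd p.1 (fun z => vvar P φ l z p.2.1 p.2.2) x
                      - pd p.1 (fun z => vvar P ψ l z p.2.1 p.2.2) x)))
      (fun l _ => add_nonneg (vnorm_nonneg _) (vnorm_nonneg _))
      (Finset.mem_range.2 (by omega : l < k - 2))
  refine main_abstract P hPdom hPtar φ ψ hφ hψ k hk hpolyφ hpolyψ D hDcpt
    (fun x => _) ?_ ?_ ?_ ?_ ?_ ?_ ?_
  · intro x
    exact add_nonneg (add_nonneg (add_nonneg (add_nonneg (add_nonneg (n1 x) (n2 x)) (n3 x))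
      (t4 x)) (t5 x)) (n6 x)
  · intro x α
    exact le_six (n1 x) (n2 x) (n3 x) (t4 x) (t5 x) (n6 x)
      (Or.inl (le_vnorm (fun α : Fin n => φ x α - ψ x α) α))
  · intro x i α
    exact le_six (n1 x) (n2 x) (n3 x) (t4 x) (t5 x) (n6 x) (Or.inr (Or.inl
      (le_vnorm (fun p : Fin m × Fin n => dphi φ x p.1 p.2 - dphi ψ x p.1 p.2) (i, α))))
  · intro x i j α
    exact le_six (n1 x) (n2 x) (n3 x) (t4 x) (t5 x) (n6 x) (Or.inr (Or.inr (Or.inl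
      (le_vnorm (fun p : Fin m × Fin m × Fin n =>
              sff P φ x p.1 p.2.1 p.2.2 - sff P ψ x p.1 p.2.1 p.2.2) (i, j, α)))))
  · intro l hl x α
    exact le_six (n1 x) (n2 x) (n3 x) (t4 x) (t5 x) (n6 x) (Or.inr (Or.inr (Or.inr (Or.inl
      ((le_vnorm (fun α : Fin n => uvar P φ l x α - uvar P ψ l x α) α).trans (m4 l hl x))))))
  · intro l hl x i α
    have hle := le_vnorm (fun p : Fin m × Fin n =>
                  vvar P φ l x p.1 p.2 - vvar P ψ l x p.1 p.2) (i, α)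
    by_cases hl' : l ≤ k - 3
    · exact le_six (n1 x) (n2 x) (n3 x) (t4 x) (t5 x) (n6 x)
        (Or.inr (Or.inr (Or.inr (Or.inr (Or.inl
          ((hle.trans (le_add_of_nonneg_right (vnorm_nonneg _))).trans (m5 l hl' x)))))))
    · obtain rfl : l = k - 2 := by omega
      exact le_six (n1 x) (n2 x) (n3 x) (t4 x) (t5 x) (n6 x)
        (Or.inr (Or.inr (Or.inr (Or.inr (Or.inr hle)))))
  · intro l hl x i j α
    have hle := le_vnorm (fun p : Fin m × Fin m × Fin n =>
                    pd p.1 (fun z => vvar P φ l z p.2.1 p.2.2) x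
                      - pd p.1 (fun z => vvar P ψ l z p.2.1 p.2.2) x) (i, j, α)
    exact le_six (n1 x) (n2 x) (n3 x) (t4 x) (t5 x) (n6 x)
        (Or.inr (Or.inr (Or.inr (Or.inr (Or.inl
          ((hle.trans (le_add_of_nonneg_left (vnorm_nonneg _))).trans (m5 l hl x)))))))

end Polyharm
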